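/- Let 𝒜 be a uniformly complete f-algebra and let p ∈ ℕ with p ≥ 2. If g ∈ 𝒜 is a finite element of 𝒜 with majorant u, then g^p is a finite element of the product algebra Π_p(𝒜) with majorant u^p. -/

import Mathlib

namespace FiniteElementsPaper

/-- Product of `p` factors `φ 0 * φ 1 * ⋯ * φ (p-1)` in a (possibly non-unital)
multiplicative structure; junk value `0` when `p = 0`. -/
def mulProd {A : Type*} [Mul A] [Zero A] : (p : ℕ) → (Fin p → A) → A
  | 0, _ => 0
  | q + 1, φ => Fin.foldl q (fun acc i => acc * φ i.succ) (φ 0)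

/-- `p`-th power `a^p` (junk value `0` for `p = 0`). -/
def mpow {A : Type*} [Mul A] [Zero A] (a : A) (p : ℕ) : A :=
  mulProd p (fun _ => a)

/-- The set `Π_p(𝒜)` of all `p`-fold products. -/
def piSet (A : Type*) [Mul A] [Zero A] (p : ℕ) : Set A :=
  {x | ∃ φ : Fin p → A, x = mulProd p φ}

variable {A : Type*} [Lattice A] [AddCommGroup A] [Module ℝ A]

/-- `z` is a majorant of `φ`: `z ≥ 0` and for every `x` there is `c > 0` with
`|x| ⊓ n • |φ| ≤ c • z` for all `n`. -/
def IsMajorant (z φ : A) : Prop :=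
  0 ≤ z ∧ ∀ x : A, ∃ c : ℝ, 0 < c ∧ ∀ n : ℕ, |x| ⊓ n • |φ| ≤ c • z

/-- `φ` is a finite element. -/
def IsFiniteElt (φ : A) : Prop := ∃ z : A, IsMajorant z φ

/-- `φ` is a totally finite element: it has a majorant which is itself finite. -/
def IsTotallyFiniteElt (φ : A) : Prop := ∃ z : A, IsMajorant z φ ∧ IsFiniteElt z

/-- `φ` is self-majorizing: `|φ|` is a majorant of `φ`. -/
def IsSelfMajorizing (φ : A) : Prop := IsMajorant |φ| φ

/-- `φ ∈ Φ₃(A) = S₊(A) - S₊(A)`. -/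
def InPhi3 (φ : A) : Prop :=
  ∃ s t : A, 0 ≤ s ∧ 0 ≤ t ∧ IsSelfMajorizing s ∧ IsSelfMajorizing t ∧ φ = s - t

/-- `w` is a majorant of `φ` relative to the subset `S` (all lattice operations
computed in the ambient algebra). -/
def IsMajorantIn (S : Set A) (w φ : A) : Prop :=
  0 ≤ w ∧ ∀ x ∈ S, ∃ c : ℝ, 0 < c ∧ ∀ n : ℕ, |x| ⊓ n • |φ| ≤ c • w

/-- `φ` is a finite element of the sublattice `S` (majorant required to lie in `S`). -/
def IsFiniteEltIn (S : Set A) (φ : A) : Prop := ∃ w ∈ S, IsMajorantIn S w φ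

/-- `φ` is a totally finite element of the sublattice `S`. -/
def IsTotallyFiniteEltIn (S : Set A) (φ : A) : Prop :=
  ∃ w ∈ S, IsMajorantIn S w φ ∧ IsFiniteEltIn S w

/-- `φ` is self-majorizing in the sublattice `S`. -/
def IsSelfMajorizingIn (S : Set A) (φ : A) : Prop := IsMajorantIn S |φ| φ

/-- `φ ∈ Φ₃(S) = S₊(S) - S₊(S)` for the sublattice `S`. -/
def InPhi3In (S : Set A) (φ : A) : Prop :=
  ∃ s t : A, s ∈ S ∧ t ∈ S ∧ 0 ≤ s ∧ 0 ≤ t ∧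
    IsSelfMajorizingIn S s ∧ IsSelfMajorizingIn S t ∧ φ = s - t

variable (A) in
/-- Archimedean ℓ-algebra structure: an Archimedean vector lattice together with an
associative bilinear multiplication whose product of positive elements is positive. -/
structure IsLAlgebra [Mul A] : Prop where
  add_le_add_left : ∀ a b : A, a ≤ b → ∀ c : A, c + a ≤ c + b
  smul_le_smul : ∀ (r : ℝ) (a b : A), 0 ≤ r → a ≤ b → r • a ≤ r • b
  archimedean : ∀ a b : A, 0 ≤ a → (∀ n : ℕ, n • a ≤ b) → a = 0
  mul_assoc : ∀ a b c : A, a * b * c = a * (b * c)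
  left_distrib : ∀ a b c : A, a * (b + c) = a * b + a * c
  right_distrib : ∀ a b c : A, (a + b) * c = a * c + b * c
  smul_mul : ∀ (r : ℝ) (a b : A), (r • a) * b = r • (a * b)
  mul_smul : ∀ (r : ℝ) (a b : A), a * (r • b) = r • (a * b)
  mul_nonneg : ∀ a b : A, 0 ≤ a → 0 ≤ b → 0 ≤ a * b

variable (A) in
/-- A `d`-algebra: ℓ-algebra in which `a ⊓ b = 0` implies `(a*c) ⊓ (b*c) = (c*a) ⊓ (c*b) = 0`
for all `c ≥ 0`. -/
structure IsDAlgebra [Mul A] extends IsLAlgebra A : Prop where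
  d_prop : ∀ a b c : A, a ⊓ b = 0 → 0 ≤ c → (a * c) ⊓ (b * c) = 0 ∧ (c * a) ⊓ (c * b) = 0

variable (A) in
/-- An `f`-algebra: ℓ-algebra in which `a ⊓ b = 0` implies `(a*c) ⊓ b = (c*a) ⊓ b = 0`
for all `c ≥ 0`. -/
structure IsFAlgebra [Mul A] extends IsLAlgebra A : Prop where
  f_prop : ∀ a b c : A, a ⊓ b = 0 → 0 ≤ c → (a * c) ⊓ b = 0 ∧ (c * a) ⊓ b = 0

/-- `e` is a multiplicative unit. -/
def IsMulUnit [Mul A] (e : A) : Prop := ∀ a : A, a * e = a ∧ e * a = a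

/-- `e` is an order unit. -/
def IsOrderUnit (e : A) : Prop := 0 ≤ e ∧ ∀ x : A, ∃ l : ℝ, 0 ≤ l ∧ |x| ≤ l • e

variable (A) in
/-- The algebra is semiprime: `0` is its only nilpotent element. -/
def IsSemiprime [Mul A] [Zero A] : Prop :=
  ∀ (a : A) (n : ℕ), 0 < n → mpow a n = 0 → a = 0

variable (A) in
/-- The vector lattice is uniformly complete. -/
def UniformlyComplete : Prop :=
  ∀ u : A, 0 ≤ u → ∀ f : ℕ → A,
    (∀ ε : ℝ, 0 < ε → ∃ K : ℕ, ∀ m n : ℕ, K ≤ m → K ≤ n → |f m - f n| ≤ ε • u) →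
    ∃ a : A, ∀ ε : ℝ, 0 < ε → ∃ K : ℕ, ∀ n : ℕ, K ≤ n → |f n - a| ≤ ε • u

variable (A) in
/-- The weak factorization property: every element is dominated by a product. -/
def WeakFactorization [Mul A] : Prop := ∀ a : A, ∃ b c : A, a ≤ b * c

section Products

variable {A : Type*} [Mul A] [Zero A]

theorem mulProd_succ_succ (q : ℕ) (φ : Fin (q + 2) → A) :
    mulProd (q + 2) φ = mulProd (q + 1) (fun i => φ i.castSucc) * φ (Fin.last (q + 1)) := by
  simp only [mulProd, Fin.foldl_succ_last, Fin.succ_last, Fin.succ_castSucc, Fin.castSucc_zero]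

theorem mpow_one (a : A) : mpow a 1 = a := by
  simp [mpow, mulProd]

theorem mpow_succ_succ (a : A) (q : ℕ) : mpow a (q + 2) = mpow a (q + 1) * a :=
  mulProd_succ_succ q _

end Products

theorem add_inf_eq_zero {A : Type*} [Lattice A] [AddCommGroup A] [IsOrderedAddMonoid A]
    {x y z : A} (hx : 0 ≤ x) (hy : 0 ≤ y) (hxz : x ⊓ z = 0) (hyz : y ⊓ z = 0) :
    (x + y) ⊓ z = 0 := by
  have hz : 0 ≤ z := hxz ▸ inf_le_right
  refine le_antisymm ?_ (le_inf (add_nonneg hx hy) hz)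
  have h : (x + y) ⊓ z - y ≤ x ⊓ z :=
    le_inf (sub_le_iff_le_add.2 inf_le_left) ((sub_le_self _ hy).trans inf_le_right)
  rw [hxz, sub_nonpos] at h
  exact (le_inf h inf_le_right).trans hyz.le

variable [Mul A]

namespace IsLAlgebra

theorem isOrderedAddMonoid (hA : IsLAlgebra A) : IsOrderedAddMonoid A where
  add_le_add_left a b h c := by
    simpa only [add_comm _ c] using hA.add_le_add_left a b h c

theorem sub_mul (hA : IsLAlgebra A) (a b c : A) : (a - b) * c = a * c - b * c := by
  rw [eq_sub_iff_add_eq, ← hA.right_distrib, sub_add_cancel]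

theorem mul_sub (hA : IsLAlgebra A) (a b c : A) : a * (b - c) = a * b - a * c := by
  rw [eq_sub_iff_add_eq, ← hA.left_distrib, sub_add_cancel]

theorem mul_le_mul (hA : IsLAlgebra A) {a b c d : A} (hab : a ≤ b) (hcd : c ≤ d)
    (hb : 0 ≤ b) (hc : 0 ≤ c) : a * c ≤ b * d := by
  have := hA.isOrderedAddMonoid
  have h₁ := hA.mul_nonneg _ _ (sub_nonneg.2 hab) hc
  have h₂ := hA.mul_nonneg _ _ hb (sub_nonneg.2 hcd)
  rw [hA.sub_mul, sub_nonneg] at h₁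
  rw [hA.mul_sub, sub_nonneg] at h₂
  exact h₁.trans h₂

theorem abs_mul_le (hA : IsLAlgebra A) (a b : A) : |a * b| ≤ |a| * |b| := by
  have := hA.isOrderedAddMonoid
  have h₁ := hA.mul_nonneg _ _ (posPart_nonneg a) (posPart_nonneg b)
  have h₂ := hA.mul_nonneg _ _ (posPart_nonneg a) (negPart_nonneg b)
  have h₃ := hA.mul_nonneg _ _ (negPart_nonneg a) (posPart_nonneg b)
  have h₄ := hA.mul_nonneg _ _ (negPart_nonneg a) (negPart_nonneg b)
  have hab : a * b = (a⁺ * b⁺ + a⁻ * b⁻) - (a⁺ * b⁻ + a⁻ * b⁺) := by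
    conv_lhs => rw [← posPart_sub_negPart a, ← posPart_sub_negPart b]
    rw [hA.sub_mul, hA.mul_sub, hA.mul_sub]
    abel
  have habs : |a| * |b| = (a⁺ * b⁺ + a⁻ * b⁻) + (a⁺ * b⁻ + a⁻ * b⁺) := by
    rw [← posPart_add_negPart a, ← posPart_add_negPart b, hA.right_distrib,
      hA.left_distrib, hA.left_distrib]
    abel
  have hp := add_nonneg h₁ h₄
  have hn := add_nonneg h₂ h₃
  rw [hab, habs, abs_le', neg_sub]
  refine ⟨(sub_le_self _ hn).trans (le_add_of_nonneg_right hn),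
    (sub_le_self _ hp).trans (le_add_of_nonneg_left hp)⟩

theorem mpow_nonneg (hA : IsLAlgebra A) {a : A} (ha : 0 ≤ a) (q : ℕ) :
    0 ≤ mpow a (q + 1) := by
  induction q with
  | zero => rwa [mpow_one]
  | succ q ih =>
    rw [mpow_succ_succ]
    exact hA.mul_nonneg _ _ ih ha

theorem mpow_le_mpow (hA : IsLAlgebra A) {a b : A} (ha : 0 ≤ a) (hab : a ≤ b) (q : ℕ) :
    mpow a (q + 1) ≤ mpow b (q + 1) := by
  induction q with
  | zero => rwa [mpow_one, mpow_one]
  | succ q ih =>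
    rw [mpow_succ_succ, mpow_succ_succ]
    exact hA.mul_le_mul ih hab (hA.mpow_nonneg (ha.trans hab) q) ha

theorem mpow_smul (hA : IsLAlgebra A) (r : ℝ) (a : A) (q : ℕ) :
    mpow (r • a) (q + 1) = r ^ (q + 1) • mpow a (q + 1) := by
  induction q with
  | zero => simp only [zero_add, mpow_one, pow_one]
  | succ q ih =>
    rw [mpow_succ_succ, mpow_succ_succ, ih, hA.smul_mul, hA.mul_smul, smul_smul, pow_succ r (q + 1)]

theorem mpow_nsmul (hA : IsLAlgebra A) (n : ℕ) (a : A) (q : ℕ) :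
    mpow (n • a) (q + 1) = n ^ (q + 1) • mpow a (q + 1) := by
  rw [← Nat.cast_smul_eq_nsmul ℝ n, hA.mpow_smul, ← Nat.cast_pow, Nat.cast_smul_eq_nsmul]

theorem abs_mulProd_le_mpow (hA : IsLAlgebra A) {h : A} (q : ℕ) (φ : Fin (q + 1) → A)
    (hφ : ∀ i, |φ i| ≤ h) : |mulProd (q + 1) φ| ≤ mpow h (q + 1) := by
  have := hA.isOrderedAddMonoid
  have hh : 0 ≤ h := (abs_nonneg _).trans (hφ 0)
  induction q with
  | zero =>
    rw [mpow_one]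
    simpa [mulProd] using hφ 0
  | succ q ih =>
    rw [mulProd_succ_succ, mpow_succ_succ]
    exact (hA.abs_mul_le _ _).trans (hA.mul_le_mul (ih _ fun i => hφ i.castSucc) (hφ _)
      (hA.mpow_nonneg hh q) (abs_nonneg _))

theorem mpow_sub_mpow (hA : IsLAlgebra A) (a d : A) (q : ℕ) :
    mpow a (q + 2) - mpow d (q + 2)
      = (mpow a (q + 1) - mpow d (q + 1)) * a + mpow d (q + 1) * (a - d) := by
  rw [mpow_succ_succ, mpow_succ_succ, hA.sub_mul, hA.mul_sub]
  abel

end IsLAlgebra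

namespace IsFAlgebra

theorem mpow_sub_mpow_inf_eq_zero (hA : IsFAlgebra A) {a d z : A} (hd : 0 ≤ d) (hda : d ≤ a)
    (hz : (a - d) ⊓ z = 0) (q : ℕ) : (mpow a (q + 1) - mpow d (q + 1)) ⊓ z = 0 := by
  have hL := hA.toIsLAlgebra
  have := hL.isOrderedAddMonoid
  induction q with
  | zero => rwa [mpow_one, mpow_one]
  | succ q ih =>
    have hdq := hL.mpow_nonneg hd q
    have ha := hd.trans hda
    rw [hL.mpow_sub_mpow]
    exact add_inf_eq_zero
      (hL.mul_nonneg _ _ (sub_nonneg.2 (hL.mpow_le_mpow hd hda q)) ha)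
      (hL.mul_nonneg _ _ hdq (sub_nonneg.2 hda))
      (hA.f_prop _ _ _ ih ha).1 (hA.f_prop _ _ _ hz hdq).2

theorem mpow_inf (hA : IsFAlgebra A) {a b : A} (ha : 0 ≤ a) (hb : 0 ≤ b) (q : ℕ) :
    mpow a (q + 1) ⊓ mpow b (q + 1) = mpow (a ⊓ b) (q + 1) := by
  have := hA.toIsLAlgebra.isOrderedAddMonoid
  have hd : 0 ≤ a ⊓ b := le_inf ha hb
  have hdisj : (a - a ⊓ b) ⊓ (b - a ⊓ b) = 0 := by
    rw [← inf_sub, sub_self]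
  have h := hA.mpow_sub_mpow_inf_eq_zero hd inf_le_left hdisj q
  rw [inf_comm] at h
  have h' := hA.mpow_sub_mpow_inf_eq_zero hd inf_le_right h q
  rwa [← inf_sub, sub_eq_zero, inf_comm] at h'

end IsFAlgebra

/-- In a uniformly complete f-algebra, if `g` is finite in `𝒜` with majorant
`u`, then `g^p` is finite in `Π_p(𝒜)` with majorant `u^p`. -/
theorem stmt12 {A : Type*} [Lattice A] [AddCommGroup A] [Module ℝ A] [Mul A]
    (hA : IsFAlgebra A) (huc : UniformlyComplete A) (p : ℕ) (hp : 2 ≤ p)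
    (g u : A) (hm : IsMajorant u g) :
    mpow u p ∈ piSet A p ∧ IsMajorantIn (piSet A p) (mpow u p) (mpow g p) := by
  have hL := hA.toIsLAlgebra
  have := hL.isOrderedAddMonoid
  obtain ⟨q, rfl⟩ : ∃ q, p = q + 1 := ⟨p - 1, by omega⟩
  obtain ⟨hu, hmaj⟩ := hm
  refine ⟨⟨fun _ => u, rfl⟩, hL.mpow_nonneg hu q, ?_⟩
  rintro _ ⟨φ, rfl⟩
  set h : A := ∑ i, |φ i|
  have hφ : ∀ i, |φ i| ≤ h := fun i =>
    Finset.single_le_sum (f := fun i => |φ i|) (fun j _ => abs_nonneg _) (Finset.mem_univ i)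
  have hh : 0 ≤ h := (abs_nonneg _).trans (hφ 0)
  obtain ⟨c, hc, hcu⟩ := hmaj h
  refine ⟨c ^ (q + 1), pow_pos hc _, fun n => ?_⟩
  have hng : 0 ≤ n • |g| := nsmul_nonneg (abs_nonneg g) n
  have hpow : n • |mpow g (q + 1)| ≤ mpow (n • |g|) (q + 1) := by
    rw [hL.mpow_nsmul]
    exact (nsmul_le_nsmul_right (hL.abs_mulProd_le_mpow q _ fun _ => le_rfl) n).trans
      (nsmul_le_nsmul_left (hL.mpow_nonneg (abs_nonneg g) q) (Nat.le_self_pow q.succ_ne_zero n))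
  calc |mulProd (q + 1) φ| ⊓ n • |mpow g (q + 1)|
      ≤ mpow h (q + 1) ⊓ mpow (n • |g|) (q + 1) :=
        inf_le_inf (hL.abs_mulProd_le_mpow q φ hφ) hpow
    _ = mpow (h ⊓ n • |g|) (q + 1) := hA.mpow_inf hh hng q
    _ ≤ mpow (c • u) (q + 1) :=
        hL.mpow_le_mpow (le_inf hh hng) (by simpa only [abs_of_nonneg hh] using hcu n) q
    _ = c ^ (q + 1) • mpow u (q + 1) := hL.mpow_smul c u q

end FiniteElementsPaper
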